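/- arXiv:1810.09534 — 16 statements merged into one kernel-verified Lean document; each statement's English description precedes it below -/
import Mathlib

section
/- Let G = (L, ∨, ∧, ⊙, →, 0, 1) be a right-residuated l-groupoid. Then G satisfies the double negation law and condition (C) if and only if G is involutive and x ⊙ y = ⌐(y → ⌐x) holds for all x, y ∈ L. -/
/-- Proposition 1: a right-residuated l-groupoid `G` satisfies the double
negation law and condition (C) iff `G` is involutive and
`x ⊙ y = ⌐(y → ⌐x)` holds for all `x, y`, where `⌐x := x → 0`. -/
theorem stmt_1 {L : Type*} [Lattice L] [BoundedOrder L]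
    (mul imp : L → L → L)
    (hone : ∀ x : L, mul ⊤ x = x)
    (hadj : ∀ x y z : L, mul x y ≤ z ↔ x ≤ imp y z) :
    ((∀ x : L, imp (imp x ⊥) ⊥ = x) ∧
      (∀ x y z : L, z ≤ mul x y ↔ imp y (imp x ⊥) ≤ imp z ⊥)) ↔
    ((∀ x y : L, x ≤ y → imp y ⊥ ≤ imp x ⊥) ∧
      (∀ x : L, imp (imp x ⊥) ⊥ = x) ∧
      (∀ x y : L, mul x y = imp (imp y (imp x ⊥)) ⊥)) := by
  constructor
  · rintro ⟨hdn, hC⟩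
    have hbot : imp ⊥ ⊥ = ⊤ := top_le_iff.mp ((hadj _ _ _).mp (hone ⊥).le)
    have htop : imp ⊤ ⊥ = ⊥ := by rw [← hbot, hdn]
    have hneg : ∀ y z : L, z ≤ y ↔ imp y ⊥ ≤ imp z ⊥ := fun y z => by
      simpa only [hone, htop] using hC ⊤ y z
    refine ⟨fun x y h => (hneg y x).mp h, hdn, fun x y => ?_⟩
    refine eq_of_forall_le_iff fun z => ?_
    rw [hC, hneg, hdn]
  · rintro ⟨hanti, hdn, hmul⟩
    refine ⟨hdn, fun x y z => ?_⟩
    rw [hmul]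
    refine ⟨fun h => ?_, fun h => ?_⟩
    · simpa only [hdn] using hanti _ _ h
    · simpa only [hdn] using hanti _ _ h
end

section
/- Let G = (L, ∨, ∧, ⊙, →, 0, 1) be an involutive right-residuated l-groupoid. Then the derived implication ⇒ satisfies, for all x, y, z ∈ L: (I0) (x ∨ y) ⇒ y = x ⇒ y, x ⇒ x = 1, and 1 ⇒ x = x; (I1) (x ⇒ y) ∧ y = y; (I2) x ≤ y implies y ⇒ z ≤ x ⇒ z; moreover x ≤ y if and only if x ⇒ y = 1. -/
/-- Lemma 2: in an involutive right-residuated l-groupoid, the derived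
implication `x ⇒ y := ⌐y → ⌐x` (with `⌐x := x → 0`) satisfies (I0), (I1),
(I2), and `x ≤ y ↔ x ⇒ y = 1`. -/
theorem stmt_3 {L : Type*} [Lattice L] [BoundedOrder L]
    (mul imp : L → L → L)
    (hone : ∀ x : L, mul ⊤ x = x)
    (hadj : ∀ x y z : L, mul x y ≤ z ↔ x ≤ imp y z)
    (hanti : ∀ x y : L, x ≤ y → imp y ⊥ ≤ imp x ⊥)
    (hdn : ∀ x : L, imp (imp x ⊥) ⊥ = x)
    (di : L → L → L)
    (hdi : ∀ x y : L, di x y = imp (imp y ⊥) (imp x ⊥)) :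
    (∀ x y : L, di (x ⊔ y) y = di x y ∧ di x x = ⊤ ∧ di ⊤ x = x) ∧
    (∀ x y : L, di x y ⊓ y = y) ∧
    (∀ x y z : L, x ≤ y → di y z ≤ di x z) ∧
    (∀ x y : L, x ≤ y ↔ di x y = ⊤) := by
  have neg_le : ∀ {x t : L}, t ≤ imp x ⊥ → x ≤ imp t ⊥ := fun {x t} h => by
    simpa [hdn] using hanti _ _ h
  have mul_le : ∀ x y : L, mul x y ≤ y := fun x y => by
    refine (hadj x y y).2 (le_top.trans ((hadj _ _ _).1 ?_))
    rw [hone]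
  have imp_mono : ∀ {y z w : L}, z ≤ w → imp y z ≤ imp y w := fun {y z w} h =>
    (hadj _ _ _).1 (((hadj _ _ _).2 le_rfl).trans h)
  have le_iff : ∀ x y : L, x ≤ y ↔ imp x y = ⊤ := fun x y => by
    rw [← top_le_iff, ← hadj, hone]
  have le_iff_di : ∀ x y : L, x ≤ y ↔ di x y = ⊤ := fun x y => by
    rw [hdi, ← le_iff]
    exact ⟨hanti x y, fun h => by simpa [hdn] using hanti _ _ h⟩
  have neg_top : imp ⊤ ⊥ = ⊥ := by
    rw [← (le_iff ⊥ ⊥).1 le_rfl, hdn]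
  refine ⟨fun x y => ⟨?_, (le_iff_di x x).1 le_rfl, ?_⟩, fun x y => ?_, fun x y z h => ?_,
    le_iff_di⟩
  · rw [hdi, hdi]
    refine le_antisymm (imp_mono (hanti _ _ le_sup_left)) ((hadj _ _ _).1 (neg_le ?_))
    exact sup_le (neg_le ((hadj _ _ _).2 le_rfl)) (neg_le (mul_le _ _))
  · rw [hdi, neg_top, hdn]
  · rw [inf_eq_right, hdi, ← hadj]
    exact ((hadj _ _ _).2 (hdn y).ge).trans bot_le
  · rw [hdi, hdi]
    exact imp_mono (hanti _ _ h)
end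

section
/- Let (L, ∨, ∧, 0, 1) be a bounded lattice, ⇒ a binary operation on L, and for a, x ∈ L with x ≥ a define x^a := x ⇒ a. Then the following are equivalent: (i) ⇒ satisfies (I0), (I1), (I2) and (I3); (ii) for each a ∈ L the map x ↦ x^a, x ∈ [a,1], is an antitone extensive mapping of [a,1] into itself such that 1^a = a and x ⇒ y = (x ∨ y)^y for all x, y ∈ L. -/
/-- Proposition 2: for a bounded lattice `L` with a binary operation `⇒`,
setting `x^a := x ⇒ a` for `x ≥ a`, the following are equivalent:
(i) `⇒` satisfies (I0), (I1), (I2) and (I3);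
(ii) for each `a`, the map `x ↦ x^a` is an antitone extensive mapping of
`[a,1]` into itself with `1^a = a`, and `x ⇒ y = (x ∨ y)^y` for all `x, y`. -/
theorem stmt_4 {L : Type*} [Lattice L] [BoundedOrder L]
    (imp : L → L → L) :
    (((∀ x y : L, imp (x ⊔ y) y = imp x y ∧ imp x x = ⊤ ∧ imp ⊤ x = x) ∧
      (∀ x y : L, imp x y ⊓ y = y) ∧
      (∀ x y z : L, x ≤ y → imp y z ≤ imp x z) ∧
      (∀ x y : L, (imp (imp x y) y) ⊓ (x ⊔ y) = x ⊔ y))) ↔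
    (∀ a : L,
      (∀ x : L, a ≤ x → a ≤ imp x a) ∧
      (∀ x y : L, a ≤ x → x ≤ y → imp y a ≤ imp x a) ∧
      (∀ x : L, a ≤ x → x ≤ imp (imp x a) a) ∧
      imp ⊤ a = a ∧
      (∀ x : L, imp x a = imp (x ⊔ a) a)) := by
  constructor
  · rintro ⟨h0, h1, h2, h3⟩ a
    refine ⟨fun x _ => inf_eq_right.mp (h1 x a), fun x y _ hxy => h2 x y a hxy, fun x _ => ?_,
      (h0 a a).2.2, fun x => (h0 x a).1.symm⟩
    exact le_sup_left.trans (inf_eq_right.mp (h3 x a))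
  · intro h
    have hsup (x y : L) : imp x y = imp (x ⊔ y) y := (h y).2.2.2.2 x
    refine ⟨fun x y => ⟨(hsup x y).symm, ?_, (h x).2.2.2.1⟩, fun x y => ?_, fun x y z hxy => ?_,
      fun x y => ?_⟩
    · have htop := (h x).2.2.1 ⊤ le_top
      rw [(h x).2.2.2.1] at htop
      exact top_le_iff.mp htop
    · rw [hsup, inf_eq_right]
      exact (h y).1 _ le_sup_right
    · rw [hsup y, hsup x]
      exact (h z).2.1 _ _ le_sup_right (sup_le_sup_right hxy z)
    · rw [hsup x, inf_eq_right]
      exact (h y).2.2.1 _ le_sup_right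
end

section
/- Let G = (L, ∨, ∧, ⊙, →, 0, 1) be an involutive right-residuated l-groupoid whose derived implication ⇒ satisfies condition (I3). For a, x ∈ L with x ≥ a define x^a := ⌐a → ⌐x. Then for each a ∈ L the map x ↦ x^a, x ∈ [a,1], is an antitone extensive mapping of [a,1] into itself with 1^a = a, and x ↦ ⌐x is an antitone involution on L. -/
/-- Theorem 1(b): let `G` be an involutive right-residuated l-groupoid whose
derived implication `x ⇒ y := ⌐y → ⌐x` satisfies (I3), where `⌐x := x → ⊥`.
Defining `x^a := ⌐a → ⌐x` for `x ≥ a`, each map `x ↦ x^a` is an antitone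
extensive mapping of `[a,1]` into itself with `1^a = a`, and `x ↦ ⌐x` is an
antitone involution on `L`. -/
theorem stmt_6 {L : Type*} [Lattice L] [BoundedOrder L]
    (mul imp : L → L → L)
    (hone : ∀ x : L, mul ⊤ x = x)
    (hadj : ∀ x y z : L, mul x y ≤ z ↔ x ≤ imp y z)
    (hanti : ∀ x y : L, x ≤ y → imp y ⊥ ≤ imp x ⊥)
    (hdn : ∀ x : L, imp (imp x ⊥) ⊥ = x)
    (di : L → L → L)
    (hdi : ∀ x y : L, di x y = imp (imp y ⊥) (imp x ⊥))
    (hI3 : ∀ x y : L, (di (di x y) y) ⊓ (x ⊔ y) = x ⊔ y)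
    (s : L → L → L)
    (hs : ∀ a x : L, a ≤ x → s a x = imp (imp a ⊥) (imp x ⊥)) :
    (∀ a : L,
      (∀ x : L, a ≤ x → a ≤ s a x) ∧
      (∀ x y : L, a ≤ x → x ≤ y → s a y ≤ s a x) ∧
      (∀ x : L, a ≤ x → x ≤ s a (s a x)) ∧
      s a ⊤ = a) ∧
    (∀ x y : L, x ≤ y → imp y ⊥ ≤ imp x ⊥) ∧
    (∀ x : L, imp (imp x ⊥) ⊥ = x) := by
  have htop : imp ⊤ ⊥ = ⊥ := le_bot_iff.mp ((hanti _ _ le_top).trans (hdn ⊥).le)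
  have hmono : ∀ y z w : L, z ≤ w → imp y z ≤ imp y w := fun y z w h =>
    (hadj _ _ _).mp (((hadj _ _ _).mpr le_rfl).trans h)
  have hs_top : ∀ a : L, s a ⊤ = a := fun a => by rw [hs a ⊤ le_top, htop, hdn]
  have hs_anti : ∀ a x y : L, a ≤ x → x ≤ y → s a y ≤ s a x := fun a x y hx hxy => by
    rw [hs a x hx, hs a y (hx.trans hxy)]
    exact hmono _ _ _ (hanti _ _ hxy)
  have hs_le : ∀ a x : L, a ≤ x → a ≤ s a x := fun a x hx =>
    (hs_top a).ge.trans (hs_anti a x ⊤ hx le_top)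
  refine ⟨fun a => ⟨hs_le a, hs_anti a, fun x hx => ?_, hs_top a⟩, hanti, hdn⟩
  rw [hs a _ (hs_le a x hx), hs a x hx, ← hdi, ← hdi]
  exact le_sup_left.trans (inf_eq_right.mp (hI3 x a))
end

section
/- Let G = (L, ∨, ∧, ⊙, →, 0, 1) be an involutive right-residuated l-groupoid. Then the following are equivalent: (i) the derived implication ⇒ satisfies identity (I3); (ii) x ⊙ y = ⌐(y → ⌐x) holds for all x, y ∈ L; (iii) G satisfies condition (C). -/
/-- Corollary 1: for an involutive right-residuated l-groupoid `G` (with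
`⌐x := x → ⊥` and derived implication `x ⇒ y := ⌐y → ⌐x`), the following are
equivalent: (i) `⇒` satisfies (I3); (ii) `x ⊙ y = ⌐(y → ⌐x)` for all `x, y`;
(iii) `G` satisfies condition (C). -/
theorem stmt_7 {L : Type*} [Lattice L] [BoundedOrder L]
    (mul imp : L → L → L)
    (hone : ∀ x : L, mul ⊤ x = x)
    (hadj : ∀ x y z : L, mul x y ≤ z ↔ x ≤ imp y z)
    (hanti : ∀ x y : L, x ≤ y → imp y ⊥ ≤ imp x ⊥)
    (hdn : ∀ x : L, imp (imp x ⊥) ⊥ = x)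
    (di : L → L → L)
    (hdi : ∀ x y : L, di x y = imp (imp y ⊥) (imp x ⊥)) :
    ((∀ x y : L, (di (di x y) y) ⊓ (x ⊔ y) = x ⊔ y) ↔
      (∀ x y : L, mul x y = imp (imp y (imp x ⊥)) ⊥)) ∧
    ((∀ x y : L, mul x y = imp (imp y (imp x ⊥)) ⊥) ↔
      (∀ x y z : L, z ≤ mul x y ↔ imp y (imp x ⊥) ≤ imp z ⊥)) := by
  have galois : ∀ z w : L, z ≤ imp w ⊥ ↔ w ≤ imp z ⊥ := fun z w =>
    ⟨fun h => by simpa only [hdn] using hanti _ _ h,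
      fun h => by simpa only [hdn] using hanti _ _ h⟩
  refine ⟨⟨fun h => ?_, fun h x y => ?_⟩, ⟨fun h x y z => ?_, fun h x y => ?_⟩⟩
  · have mul_le : ∀ x y : L, mul x y ≤ imp (imp y (imp x ⊥)) ⊥ := fun x y => by
      have hxy := le_sup_left.trans (inf_eq_right.mp (h x (imp y ⊥)))
      simp only [hdi, hdn] at hxy
      exact (hadj _ _ _).mpr hxy
    intro x y
    refine le_antisymm (mul_le x y) ?_
    have hle : imp (mul x y) ⊥ ≤ imp y (imp x ⊥) := by
      refine (hadj _ _ _).mp ((mul_le _ y).trans ?_)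
      rw [hdn]
      exact hanti _ _ ((hadj _ _ _).mp le_rfl)
    simpa only [hdn] using hanti _ _ hle
  · rw [inf_eq_right, hdi, hdi]
    refine sup_le ((hadj _ _ _).mp (h _ _).le) ((hadj _ _ _).mp ?_)
    exact ((hadj _ _ _).mpr (hdn y).ge).trans bot_le
  · rw [h]
    exact galois _ _
  · exact eq_of_forall_le_iff fun z => (h x y z).trans (galois _ _).symm
end

section
/- Let G = (L, ∨, ∧, ⊙, →, 0, 1) be an involutive right-residuated l-groupoid satisfying x ⊙ y = ⌐(y → ⌐x) for all x, y ∈ L, and let ⇒ be its derived implication. Then G is integral if and only if x ⇒ 0 = x → 0 for all x ∈ L. -/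
/-- Theorem 2(i): for an involutive right-residuated l-groupoid `G` with
`x ⊙ y = ⌐(y → ⌐x)` (where `⌐x := x → ⊥`) and derived implication
`x ⇒ y := ⌐y → ⌐x`, `G` is integral iff `x ⇒ ⊥ = x → ⊥` for all `x`. -/
theorem stmt_8 {L : Type*} [Lattice L] [BoundedOrder L]
    (mul imp : L → L → L)
    (hone : ∀ x : L, mul ⊤ x = x)
    (hadj : ∀ x y z : L, mul x y ≤ z ↔ x ≤ imp y z)
    (hanti : ∀ x y : L, x ≤ y → imp y ⊥ ≤ imp x ⊥)
    (hdn : ∀ x : L, imp (imp x ⊥) ⊥ = x)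
    (hC : ∀ x y : L, mul x y = imp (imp y (imp x ⊥)) ⊥)
    (di : L → L → L)
    (hdi : ∀ x y : L, di x y = imp (imp y ⊥) (imp x ⊥)) :
    (∀ x : L, mul ⊤ x = x ∧ mul x ⊤ = x) ↔ (∀ x : L, di x ⊥ = imp x ⊥) := by
  have hbot : imp ⊥ ⊥ = ⊤ := by
    have h := hanti ⊥ (imp ⊤ ⊥) bot_le
    rw [hdn] at h
    exact top_le_iff.mp h
  constructor
  · intro h x
    have hx := (h x).2
    rw [hC] at hx
    rw [hdi, hbot, ← hdn (imp ⊤ (imp x ⊥)), hx]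
  · intro h x
    have hx := h x
    rw [hdi, hbot] at hx
    exact ⟨hone x, by rw [hC, hx, hdn]⟩
end

section
/- Let G = (L, ∨, ∧, ⊙, →, 0, 1) be an involutive right-residuated l-groupoid satisfying x ⊙ y = ⌐(y → ⌐x) for all x, y ∈ L, and let ⇒ be its derived implication. Then ⊙ is commutative (x ⊙ y = y ⊙ x for all x, y ∈ L) if and only if the operations ⇒ and → coincide. -/
/-- Theorem 2(ii): for an involutive right-residuated l-groupoid `G` with
`x ⊙ y = ⌐(y → ⌐x)` (where `⌐x := x → ⊥`) and derived implication
`x ⇒ y := ⌐y → ⌐x`, the operation `⊙` is commutative iff `⇒` and `→`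
coincide. -/
theorem stmt_9 {L : Type*} [Lattice L] [BoundedOrder L]
    (mul imp : L → L → L)
    (hone : ∀ x : L, mul ⊤ x = x)
    (hadj : ∀ x y z : L, mul x y ≤ z ↔ x ≤ imp y z)
    (hanti : ∀ x y : L, x ≤ y → imp y ⊥ ≤ imp x ⊥)
    (hdn : ∀ x : L, imp (imp x ⊥) ⊥ = x)
    (hC : ∀ x y : L, mul x y = imp (imp y (imp x ⊥)) ⊥)
    (di : L → L → L)
    (hdi : ∀ x y : L, di x y = imp (imp y ⊥) (imp x ⊥)) :
    (∀ x y : L, mul x y = mul y x) ↔ (∀ x y : L, di x y = imp x y) := by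
  have himp : ∀ x y : L, imp x y = imp (mul (imp y ⊥) x) ⊥ := fun x y => by
    rw [hC, hdn, hdn]
  constructor
  · intro hcomm x y
    rw [hdi, himp (imp y ⊥), hdn, hcomm, ← himp]
  · intro hcoin x y
    rw [hC x y, hC y x, ← hcoin y, hdi, hdn]
end

section
/- Let G = (L, ∨, ∧, ⊙, →, 0, 1) be an involutive right-residuated l-groupoid satisfying x ⊙ y = ⌐(y → ⌐x) for all x, y ∈ L, and let ⇒ be its derived implication. Then ⊙ is associative if and only if (x ⊙ y) ⇒ z = x ⇒ (y ⇒ z) holds for all x, y, z ∈ L. -/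
/-- Theorem 2(iii): for an involutive right-residuated l-groupoid `G` with
`x ⊙ y = ⌐(y → ⌐x)` (where `⌐x := x → ⊥`) and derived implication
`x ⇒ y := ⌐y → ⌐x`, the operation `⊙` is associative iff
`(x ⊙ y) ⇒ z = x ⇒ (y ⇒ z)` for all `x, y, z`. -/
theorem stmt_10 {L : Type*} [Lattice L] [BoundedOrder L]
    (mul imp : L → L → L)
    (hone : ∀ x : L, mul ⊤ x = x)
    (hadj : ∀ x y z : L, mul x y ≤ z ↔ x ≤ imp y z)
    (hanti : ∀ x y : L, x ≤ y → imp y ⊥ ≤ imp x ⊥)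
    (hdn : ∀ x : L, imp (imp x ⊥) ⊥ = x)
    (hC : ∀ x y : L, mul x y = imp (imp y (imp x ⊥)) ⊥)
    (di : L → L → L)
    (hdi : ∀ x y : L, di x y = imp (imp y ⊥) (imp x ⊥)) :
    (∀ x y z : L, mul (mul x y) z = mul x (mul y z)) ↔
      (∀ x y z : L, di (mul x y) z = di x (di y z)) := by
  have hdm : ∀ x y : L, di x y = imp (mul x (imp y ⊥)) ⊥ := fun x y => by
    rw [hdi, hC, hdn]
  have hinj : ∀ a b : L, imp a ⊥ = imp b ⊥ → a = b := fun a b h => by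
    rw [← hdn a, h, hdn]
  constructor
  · intro h x y z
    simp only [hdm, hdn, h]
  · intro h x y z
    have hz := h x y (imp z ⊥)
    simp only [hdm, hdn] at hz
    exact hinj _ _ hz
end

section
/- Let G = (L, ∨, ∧, ⊙, →, 0, 1) be an involutive right-residuated l-groupoid whose derived implication ⇒ satisfies condition (I3). If ⊙ is associative, then ⊙ is commutative and G is integral (so that G is an integral commutative residuated lattice). -/
/-- Corollary 2: let `G` be an involutive right-residuated l-groupoid whose
derived implication `x ⇒ y := ⌐y → ⌐x` satisfies (I3), where `⌐x := x → ⊥`.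
If `⊙` is associative, then `⊙` is commutative and `G` is integral. -/
theorem stmt_11 {L : Type*} [Lattice L] [BoundedOrder L]
    (mul imp : L → L → L)
    (hone : ∀ x : L, mul ⊤ x = x)
    (hadj : ∀ x y z : L, mul x y ≤ z ↔ x ≤ imp y z)
    (hanti : ∀ x y : L, x ≤ y → imp y ⊥ ≤ imp x ⊥)
    (hdn : ∀ x : L, imp (imp x ⊥) ⊥ = x)
    (di : L → L → L)
    (hdi : ∀ x y : L, di x y = imp (imp y ⊥) (imp x ⊥))
    (hI3 : ∀ x y : L, (di (di x y) y) ⊓ (x ⊔ y) = x ⊔ y)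
    (hassoc : ∀ x y z : L, mul (mul x y) z = mul x (mul y z)) :
    (∀ x y : L, mul x y = mul y x) ∧ (∀ x : L, mul ⊤ x = x ∧ mul x ⊤ = x) := by
  have imp_eq (y z : L) : imp y (imp z ⊥) = imp (mul y z) ⊥ :=
    eq_of_forall_le_iff fun x => by
      rw [← hadj, ← hadj, ← hadj, hassoc]
  have mul_le_comm (x y : L) : mul x y ≤ mul y x := by
    have h : x ≤ di (di x (imp y ⊥)) (imp y ⊥) :=
      le_sup_left.trans (inf_eq_right.mp (hI3 x (imp y ⊥)))
    rw [hdi, ← hadj, hdi, hdn, imp_eq, hdn] at h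
    exact h
  have mul_comm' (x y : L) : mul x y = mul y x :=
    le_antisymm (mul_le_comm x y) (mul_le_comm y x)
  exact ⟨mul_comm', fun x => ⟨hone x, (mul_comm' x ⊤).trans (hone x)⟩⟩
end

section
/- Let G = (L, ∨, ∧, ⊙, →, 0, 1) be a right-residuated l-groupoid with derived implication ⇒. Then the following are equivalent: (i) (x ⇒ y) ⇒ y = (y ⇒ x) ⇒ x for all x, y ∈ L, and G is involutive; (ii) ⇒ satisfies (I3*) and G is involutive; (iii) G satisfies the double negation law, divisibility, and condition (C). -/
section RightResiduated

variable {L : Type*} [Lattice L]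

/-- An antitone involution turns meets into joins. -/
theorem antitone_involution_inf (n : L → L) (anti : ∀ x y, x ≤ y → n y ≤ n x)
    (inv : ∀ x, n (n x) = x) (x y : L) : n (n x ⊓ n y) = x ⊔ y := by
  apply le_antisymm
  · rw [← inv (x ⊔ y)]
    exact anti _ _ (le_inf (anti _ _ le_sup_left) (anti _ _ le_sup_right))
  · apply sup_le
    · simpa only [inv] using anti _ _ (inf_le_left : n x ⊓ n y ≤ n x)
    · simpa only [inv] using anti _ _ (inf_le_right : n x ⊓ n y ≤ n y)

/-- An antitone involution can be moved across an inequality. -/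
theorem antitone_involution_le_comm (n : L → L) (anti : ∀ x y, x ≤ y → n y ≤ n x)
    (inv : ∀ x, n (n x) = x) (x y : L) : x ≤ n y ↔ y ≤ n x :=
  ⟨fun h => by simpa only [inv] using anti _ _ h,
    fun h => by simpa only [inv] using anti _ _ h⟩

variable (mul imp : L → L → L)

theorem imp_mono_right (hadj : ∀ x y z : L, mul x y ≤ z ↔ x ≤ imp y z)
    {y z w : L} (h : z ≤ w) : imp y z ≤ imp y w :=
  (hadj _ _ _).1 (((hadj _ _ _).2 le_rfl).trans h)

theorem imp_eq_top_of_le [BoundedOrder L] (hone : ∀ x : L, mul ⊤ x = x)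
    (hadj : ∀ x y z : L, mul x y ≤ z ↔ x ≤ imp y z) {y z : L} (h : y ≤ z) :
    imp y z = ⊤ :=
  top_le_iff.1 ((hadj _ _ _).1 ((hone y).le.trans h))

theorem imp_top_bot [BoundedOrder L] (hone : ∀ x : L, mul ⊤ x = x)
    (hadj : ∀ x y z : L, mul x y ≤ z ↔ x ≤ imp y z)
    (inv : ∀ x : L, imp (imp x ⊥) ⊥ = x) : imp (⊤ : L) ⊥ = ⊥ := by
  simpa only [imp_eq_top_of_le mul imp hone hadj (le_refl (⊥ : L))] using inv ⊥

end RightResiduated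


/-- Proposition 4: for a right-residuated l-groupoid `G` with `⌐x := x → ⊥`
and derived implication `x ⇒ y := ⌐y → ⌐x`, the following are equivalent:
(i) the Łukasiewicz identity `(x ⇒ y) ⇒ y = (y ⇒ x) ⇒ x` holds and `G` is
involutive; (ii) `⇒` satisfies (I3*) and `G` is involutive; (iii) `G`
satisfies the double negation law, divisibility, and condition (C). -/
theorem stmt_13 {L : Type*} [Lattice L] [BoundedOrder L]
    (mul imp : L → L → L)
    (hone : ∀ x : L, mul ⊤ x = x)
    (hadj : ∀ x y z : L, mul x y ≤ z ↔ x ≤ imp y z)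
    (di : L → L → L)
    (hdi : ∀ x y : L, di x y = imp (imp y ⊥) (imp x ⊥)) :
    (((∀ x y : L, di (di x y) y = di (di y x) x) ∧
        (∀ x y : L, x ≤ y → imp y ⊥ ≤ imp x ⊥) ∧
        (∀ x : L, imp (imp x ⊥) ⊥ = x)) ↔
      ((∀ x y : L, di (di x y) y = x ⊔ y) ∧
        (∀ x y : L, x ≤ y → imp y ⊥ ≤ imp x ⊥) ∧
        (∀ x : L, imp (imp x ⊥) ⊥ = x))) ∧
    (((∀ x y : L, di (di x y) y = x ⊔ y) ∧
        (∀ x y : L, x ≤ y → imp y ⊥ ≤ imp x ⊥) ∧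
        (∀ x : L, imp (imp x ⊥) ⊥ = x)) ↔
      ((∀ x : L, imp (imp x ⊥) ⊥ = x) ∧
        (∀ x y : L, mul (imp x y) x = x ⊓ y) ∧
        (∀ x y z : L, z ≤ mul x y ↔ imp y (imp x ⊥) ≤ imp z ⊥))) := by
  have mono : ∀ y z w : L, z ≤ w → imp y z ≤ imp y w :=
    fun _ _ _ => imp_mono_right mul imp hadj
  refine ⟨⟨?_, ?_⟩, ⟨?_, ?_⟩⟩
  · rintro ⟨luk, anti, inv⟩
    refine ⟨fun x y => ?_, anti, inv⟩
    have di_anti : ∀ x x' y : L, x ≤ x' → di x' y ≤ di x y := by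
      intro x x' y h
      rw [hdi, hdi]
      exact mono _ _ _ (anti _ _ h)
    have le_di : ∀ w y : L, y ≤ di w y := by
      intro w y
      rw [hdi]
      exact (inv y).ge.trans (mono _ _ _ bot_le)
    apply le_antisymm
    · calc di (di x y) y ≤ di (di (x ⊔ y) y) y :=
            di_anti _ _ _ (di_anti _ _ _ le_sup_left)
        _ = di (di y (x ⊔ y)) (x ⊔ y) := luk _ _
        _ = di ⊤ (x ⊔ y) := by
            rw [hdi y, imp_eq_top_of_le mul imp hone hadj (anti _ _ le_sup_right)]
        _ = x ⊔ y := by rw [hdi, imp_top_bot mul imp hone hadj inv, inv]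
    · refine sup_le ?_ (le_di _ _)
      rw [luk]
      exact le_di _ _
  · rintro ⟨join, anti, inv⟩
    exact ⟨fun x y => by rw [join, join, sup_comm], anti, inv⟩
  · rintro ⟨join, anti, inv⟩
    have swap : ∀ u v x : L, x ≤ di u v → u ≤ di x v := by
      intro u v x h
      refine (le_sup_left.trans (join u v).ge).trans ?_
      rw [hdi (di u v), hdi x]
      exact mono _ _ _ (anti _ _ h)
    have comm := antitone_involution_le_comm (fun x : L => imp x ⊥) anti inv
    have mul_eq : ∀ x y : L, mul x y = imp (imp y (imp x ⊥)) ⊥ := by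
      intro x y
      refine eq_of_forall_ge_iff fun w => ?_
      have h1 : imp y w = di (imp w ⊥) (imp y ⊥) := by rw [hdi, inv, inv]
      have h2 : imp y (imp x ⊥) = di x (imp y ⊥) := by rw [hdi, inv]
      have h3 : imp w ⊥ ≤ imp y (imp x ⊥) ↔ imp (imp y (imp x ⊥)) ⊥ ≤ w :=
        ⟨fun h => (anti _ _ h).trans (inv w).le,
          fun h => (anti _ _ h).trans (inv _).le⟩
      rw [hadj, ← h3, h1, h2]
      exact ⟨swap _ _ _, swap _ _ _⟩
    refine ⟨inv, fun x y => ?_, fun x y z => ?_⟩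
    · have h := join (imp y ⊥) (imp x ⊥)
      rw [hdi (di _ _), hdi, inv, inv] at h
      rw [mul_eq, h, sup_comm,
        ← antitone_involution_inf (fun x : L => imp x ⊥) anti inv]
      simp only [inv]
    · rw [mul_eq]
      exact comm _ _
  · rintro ⟨inv, divis, adj⟩
    have anti : ∀ x y : L, x ≤ y → imp y ⊥ ≤ imp x ⊥ := by
      intro x y h
      simpa only [imp_top_bot mul imp hone hadj inv] using
        (adj ⊤ y x).1 (h.trans (hone y).ge)
    have comm := antitone_involution_le_comm (fun x : L => imp x ⊥) anti inv
    have mul_eq : ∀ x y : L, mul x y = imp (imp y (imp x ⊥)) ⊥ := fun x y =>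
      eq_of_forall_le_iff fun z => (adj x y z).trans (comm _ _)
    refine ⟨fun x y => ?_, anti, inv⟩
    have h := divis (imp y ⊥) (imp x ⊥)
    rw [mul_eq] at h
    rw [hdi (di x y), hdi, ← inv (imp (imp y ⊥) _), h, sup_comm]
    exact antitone_involution_inf (fun x : L => imp x ⊥) anti inv y x
end

section
/- Let L = (L, ∨, ∧, {^a : a ∈ L}, 0, 1) be a bounded lattice with sectionally antitone involutions x ↦ x^a, x ∈ [a,1]. Define ∼x := x^0, x → y := (∼x ∨ ∼y)^{∼x} and x ⊙ y := ∼[(x ∨ ∼y)^{∼y}] for all x, y ∈ L. Then G(L) = (L, ∨, ∧, ⊙, →, 0, 1) is an involutive integral right-residuated l-groupoid with x → 0 = ∼x, and its derived implication ⇒ satisfies (I3*). -/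
/-- Theorem 3(a): let `L` be a bounded lattice with sectionally antitone
involutions `x ↦ x^a` of `[a,1]` (written `s a x`).  Define `∼x := x^⊥`,
`x → y := (∼x ∨ ∼y)^{∼x}` and `x ⊙ y := ∼[(x ∨ ∼y)^{∼y}]`.  Then the
resulting algebra is an involutive integral right-residuated l-groupoid with
`x → ⊥ = ∼x`, whose derived implication `x ⇒ y := ⌐y → ⌐x` satisfies
(I3*). -/
theorem stmt_14 {L : Type*} [Lattice L] [BoundedOrder L]
    (s : L → L → L)
    (hsmem : ∀ a x : L, a ≤ x → a ≤ s a x)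
    (hsanti : ∀ a x y : L, a ≤ x → x ≤ y → s a y ≤ s a x)
    (hsinv : ∀ a x : L, a ≤ x → s a (s a x) = x)
    (neg : L → L) (hneg : ∀ x : L, neg x = s ⊥ x)
    (mul imp : L → L → L)
    (himp : ∀ x y : L, imp x y = s (neg x) (neg x ⊔ neg y))
    (hmul : ∀ x y : L, mul x y = neg (s (neg y) (x ⊔ neg y))) :
    (∀ x : L, mul ⊤ x = x) ∧
    (∀ x y z : L, mul x y ≤ z ↔ x ≤ imp y z) ∧
    (∀ x : L, mul x ⊤ = x) ∧
    (∀ x : L, imp x ⊥ = neg x) ∧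
    (∀ x y : L, x ≤ y → imp y ⊥ ≤ imp x ⊥) ∧
    (∀ x : L, imp (imp x ⊥) ⊥ = x) ∧
    (∀ x y : L,
      imp (imp y ⊥) (imp (imp (imp y ⊥) (imp x ⊥)) ⊥) = x ⊔ y) := by
  have section_top : ∀ a : L, s a a = ⊤ := fun a => by
    have h := hsanti a a (s a ⊤) le_rfl (hsmem a ⊤ le_top)
    rw [hsinv a ⊤ le_top] at h
    exact top_le_iff.mp h
  have section_bot : ∀ a : L, s a ⊤ = a := fun a => by
    rw [← section_top a, hsinv a a le_rfl]
  have neg_neg' : ∀ x : L, neg (neg x) = x := fun x => by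
    rw [hneg, hneg, hsinv ⊥ x bot_le]
  have neg_anti : ∀ x y : L, x ≤ y → neg y ≤ neg x := fun x y h => by
    rw [hneg, hneg]
    exact hsanti ⊥ x y bot_le h
  have neg_top : neg ⊤ = ⊥ := by rw [hneg, section_bot]
  have neg_bot : neg ⊥ = ⊤ := by rw [hneg, section_top]
  have imp_bot : ∀ x : L, imp x ⊥ = neg x := fun x => by
    rw [himp, neg_bot, sup_top_eq, section_bot]
  have section_comm : ∀ a u v : L, a ≤ u → a ≤ v → u ≤ s a v → v ≤ s a u :=
    fun a u v hu hv h => by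
      have h' := hsanti a u (s a v) hu h
      rwa [hsinv a v hv] at h'
  refine ⟨fun x => ?_, fun x y z => ?_, fun x => ?_, imp_bot, fun x y h => ?_,
    fun x => ?_, fun x y => ?_⟩
  · rw [hmul, top_sup_eq, section_bot, neg_neg']
  · rw [hmul, himp]
    constructor
    · intro h
      have hz := neg_anti _ _ h
      rw [neg_neg'] at hz
      exact le_sup_left.trans (section_comm _ _ _ le_sup_left le_sup_right
        (sup_le (hsmem _ _ le_sup_right) hz))
    · intro h
      have hx := section_comm _ _ _ le_sup_right le_sup_left
        (sup_le h (hsmem (neg y) (neg y ⊔ neg z) le_sup_left))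
      have hz := neg_anti _ _ (le_sup_right.trans hx)
      rwa [neg_neg'] at hz
  · rw [hmul, neg_top, sup_bot_eq, ← hneg, neg_neg']
  · rw [imp_bot, imp_bot]
    exact neg_anti x y h
  · rw [imp_bot, imp_bot, neg_neg']
  · simp only [imp_bot, himp, neg_neg']
    rw [sup_eq_right.mpr (hsmem y (y ⊔ x) le_sup_left), hsinv y _ le_sup_left, sup_comm]
end

section
/- Let A = (A, ⊕, ⌐, 0) be a basic algebra. Define x ⊙ y := ⌐(⌐x ⊕ ⌐y), x → y := y ⊕ ⌐x, x ∨ y := ⌐(⌐x ⊕ y) ⊕ y, x ∧ y := ⌐(⌐x ∨ ⌐y), and 1 := ⌐0. Then G(A) = (A, ∨, ∧, ⊙, →, 0, 1) is a right-residuated l-groupoid of Łukasiewicz type (in particular, (A, ∨, ∧, 0, 1) is a bounded lattice, G(A) is integral and involutive, and its derived implication satisfies (x ⇒ y) ⇒ y = (y ⇒ x) ⇒ x). -/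
/-- Theorem 5(a): let `(A, ⊕, ⌐, 0)` be a basic algebra (written `p`, `n`,
`z`), `1 := ⌐0`.  Define `x ⊙ y := ⌐(⌐x ⊕ ⌐y)`, `x → y := y ⊕ ⌐x`,
`x ∨ y := ⌐(⌐x ⊕ y) ⊕ y`, `x ∧ y := ⌐(⌐x ∨ ⌐y)`, and order `x ≤ y` iff
`⌐x ⊕ y = 1`.  Then the result is a right-residuated l-groupoid of
Łukasiewicz type: `(A, ∨, ∧, 0, 1)` is a bounded lattice, `1 ⊙ x = x`,
right-adjointness holds, and the algebra is integral and involutive and its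
derived implication satisfies the Łukasiewicz identity. -/
theorem stmt_15 {A : Type*} (p : A → A → A) (n : A → A) (z : A)
    (BA1 : ∀ x : A, p x z = x)
    (BA2 : ∀ x : A, n (n x) = x)
    (BA3 : ∀ x y : A, p (n (p (n x) y)) y = p (n (p (n y) x)) x)
    (BA4 : ∀ x y w : A, p (n (p (n (p (n (p x y)) y)) w)) (p x w) = n z)
    (one : A) (hone : one = n z)
    (le : A → A → Prop) (hle : ∀ x y : A, le x y ↔ p (n x) y = one)
    (sup inf mul imp : A → A → A)
    (hsup : ∀ x y : A, sup x y = p (n (p (n x) y)) y)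
    (hinf : ∀ x y : A, inf x y = n (sup (n x) (n y)))
    (hmul : ∀ x y : A, mul x y = n (p (n x) (n y)))
    (himp : ∀ x y : A, imp x y = p y (n x)) :
    -- `le` is a partial order
    (∀ x : A, le x x) ∧
    (∀ x y : A, le x y → le y x → x = y) ∧
    (∀ x y w : A, le x y → le y w → le x w) ∧
    -- `sup` and `inf` are lattice operations, `z` is least and `one` greatest
    (∀ x y : A, le x (sup x y) ∧ le y (sup x y) ∧
      ∀ c : A, le x c → le y c → le (sup x y) c) ∧
    (∀ x y : A, le (inf x y) x ∧ le (inf x y) y ∧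
      ∀ c : A, le c x → le c y → le c (inf x y)) ∧
    (∀ x : A, le z x) ∧ (∀ x : A, le x one) ∧
    -- right-residuated l-groupoid, integral
    (∀ x : A, mul one x = x) ∧
    (∀ x : A, mul x one = x) ∧
    (∀ x y w : A, le (mul x y) w ↔ le x (imp y w)) ∧
    -- involutive (with `⌐x := x → 0`)
    (∀ x y : A, le x y → le (imp y z) (imp x z)) ∧
    (∀ x : A, imp (imp x z) z = x) ∧
    -- Łukasiewicz identity for the derived implication `x ⇒ y := ⌐y → ⌐x`
    (∀ x y : A,
      imp (imp y z) (imp (imp (imp y z) (imp x z)) z) =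
      imp (imp x z) (imp (imp (imp x z) (imp y z)) z)) := by
  subst hone
  obtain rfl : sup = fun x y => p (n (p (n x) y)) y := funext₂ hsup
  obtain rfl : inf = fun x y => n (p (n (p (n (n x)) (n y))) (n y)) := funext₂ hinf
  obtain rfl : mul = fun x y => n (p (n x) (n y)) := funext₂ hmul
  obtain rfl : imp = fun x y => p y (n x) := funext₂ himp
  have n_one : n (n z) = z := BA2 z
  have refl' : ∀ x, p (n x) x = n z := fun x => by
    simpa only [BA1, BA2] using BA4 x z z
  have sup_zero : ∀ x, p (n (p (n z) x)) x = x := fun x => by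
    rw [← BA3, BA1, BA1, BA2]
  have sup_add : ∀ x y, p (p (n (p x y)) y) x = n z := fun x y => by
    simpa only [BA1, BA2] using BA4 x y z
  have add_one : ∀ y, p y (n z) = n z := fun y => by
    have h := sup_add (n z) y
    rwa [sup_zero] at h
  have one_add : ∀ x, p (n z) x = n z := fun x => by
    have h := sup_add x (n z)
    rwa [add_one] at h
  have zero_add : ∀ x, p z x = x := fun x => by
    have h := sup_zero x
    rwa [one_add, n_one] at h
  have sup_eq : ∀ x y, p (n x) y = n z → p (n (p (n x) y)) y = y := fun x y h => by
    rw [h, n_one, zero_add]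
  have flip : ∀ a b, p a b = n z → p b a = n z := fun a b h => by
    have h' := sup_add a b
    rwa [h, n_one, zero_add] at h'
  have le_sup_left : ∀ x y, p (n x) (p (n (p (n x) y)) y) = n z := fun x y =>
    flip _ _ (sup_add (n x) y)
  have le_sup_right : ∀ x y, p (n y) (p (n (p (n x) y)) y) = n z := fun x y => by
    rw [BA3]
    exact le_sup_left y x
  have anti : ∀ a b w, p (n a) b = n z → p (n (p (n b) w)) (p (n a) w) = n z :=
    fun a b w h => by
      have h' := BA4 (n a) b w
      rwa [sup_eq a b h] at h'
  have trans' : ∀ a b c, p (n a) b = n z → p (n b) c = n z → p (n a) c = n z :=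
    fun a b c hab hbc => by
      have h := anti a b c hab
      rwa [hbc, n_one, zero_add] at h
  have sup_le : ∀ x y c, p (n x) c = n z → p (n y) c = n z →
      p (n (p (n (p (n x) y)) y)) c = n z := fun x y c hx hy => by
    have h := anti _ _ y (anti x c y hx)
    rwa [BA3 c y, sup_eq y c hy] at h
  have neg_le : ∀ x y, p (n x) y = n z → p (n (n y)) (n x) = n z := fun x y h => by
    rw [BA2]
    exact flip _ _ h
  have assoc : ∀ a b w, p w (p a b) = n z → p a (p w b) = n z := fun a b w h => by
    have h1 := anti (n w) (p a b) b (by rwa [BA2])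
    have h2 := trans' (n a) _ _ (by simpa only [BA2] using le_sup_left (n a) b) h1
    simpa only [BA2] using h2
  simp only [hle, zero_add, BA2]
  refine ⟨refl', ?_, trans', ?_, ?_, one_add, fun x => add_one _, fun _ => trivial, ?_, ?_, ?_, ?_, ?_⟩
  · intro x y hxy hyx
    have h := BA3 x y
    rw [sup_eq x y hxy, sup_eq y x hyx] at h
    exact h.symm
  · exact fun x y => ⟨le_sup_left x y, le_sup_right x y, sup_le x y⟩
  · refine fun x y => ⟨?_, ?_, fun c hx hy => ?_⟩
    · simpa only [BA2] using flip _ _ (le_sup_left (n x) (n y))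
    · simpa only [BA2] using flip _ _ (le_sup_right (n x) (n y))
    · have h := sup_le (n x) (n y) (n c) (neg_le c x hx) (neg_le c y hy)
      simpa only [BA2] using flip _ _ h
  · intro x
    rw [BA1, BA2]
  · exact fun x y w => ⟨fun h => assoc _ _ _ (flip _ _ h), fun h => flip _ _ (assoc _ _ _ h)⟩
  · exact fun x y h => flip _ _ h
  · exact fun _ => trivial
  · exact BA3
end

section
/- Let G = (A, ∨, ∧, ⊙, →, 0, 1) be a right-residuated l-groupoid of Łukasiewicz type. Define ⌐x := x → 0 and x ⊕ y := ⌐(⌐x ⊙ ⌐y) for all x, y ∈ A. Then A(G) = (A, ⊕, ⌐, 0) is a basic algebra. -/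
/-- Theorem 5(b): let `G` be a right-residuated l-groupoid of Łukasiewicz
type (integral, involutive, with derived implication `x ⇒ y := ⌐y → ⌐x`
satisfying the Łukasiewicz identity, where `⌐x := x → ⊥`).  Define
`⌐x := x → ⊥` (written `neg`) and `x ⊕ y := ⌐(⌐x ⊙ ⌐y)` (written `plus`).
Then `(A, ⊕, ⌐, ⊥)` is a basic algebra (with `1 := ⌐⊥`). -/
theorem stmt_16 {A : Type*} [Lattice A] [BoundedOrder A]
    (mul imp : A → A → A)
    (hone : ∀ x : A, mul ⊤ x = x)
    (hadj : ∀ x y z : A, mul x y ≤ z ↔ x ≤ imp y z)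
    (hint : ∀ x : A, mul x ⊤ = x)
    (hanti : ∀ x y : A, x ≤ y → imp y ⊥ ≤ imp x ⊥)
    (hdn : ∀ x : A, imp (imp x ⊥) ⊥ = x)
    (di : A → A → A)
    (hdi : ∀ x y : A, di x y = imp (imp y ⊥) (imp x ⊥))
    (hLuk : ∀ x y : A, di (di x y) y = di (di y x) x)
    (neg : A → A) (hneg : ∀ x : A, neg x = imp x ⊥)
    (plus : A → A → A)
    (hplus : ∀ x y : A, plus x y = neg (mul (neg x) (neg y))) :
    (∀ x : A, plus x ⊥ = x) ∧
    (∀ x : A, neg (neg x) = x) ∧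
    (∀ x y : A, plus (neg (plus (neg x) y)) y = plus (neg (plus (neg y) x)) x) ∧
    (∀ x y z : A,
      plus (neg (plus (neg (plus (neg (plus x y)) y)) z)) (plus x z) = neg ⊥) := by
  have neg_neg' : ∀ x : A, neg (neg x) = x := fun x => by rw [hneg, hneg, hdn]
  have neg_le_neg_iff' : ∀ x y : A, neg y ≤ neg x ↔ x ≤ y := fun x y => by
    rw [hneg, hneg]
    exact ⟨fun h => by simpa only [hdn] using hanti _ _ h, hanti x y⟩
  have neg_bot : neg ⊥ = ⊤ := by
    rw [hneg]
    exact top_le_iff.mp ((hadj ⊤ ⊥ ⊥).mp (hone ⊥).le)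
  have le_di_iff : ∀ x y z : A, z ≤ di x y ↔ mul z (neg y) ≤ neg x := fun x y z => by
    rw [hdi, hneg, hneg, hadj]
  have di_anti : ∀ x y z : A, x ≤ y → di y z ≤ di x z := fun x y z h =>
    (le_di_iff x z _).mpr
      (((le_di_iff y z _).mp le_rfl).trans ((neg_le_neg_iff' x y).mpr h))
  have di_eq_top : ∀ x y : A, x ≤ y → di x y = ⊤ := fun x y h =>
    top_le_iff.mp ((le_di_iff x y ⊤).mpr (by rwa [hone, neg_le_neg_iff']))
  have le_di : ∀ x y : A, y ≤ di x y := fun x y => by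
    rw [le_di_iff]
    exact ((hadj y (neg y) ⊥).mpr (by rw [← hneg, neg_neg'])).trans bot_le
  have le_di_di : ∀ x y : A, x ≤ di (di x y) y := fun x y => by
    rw [hLuk]
    exact le_di _ _
  have le_di_comm : ∀ x y z : A, x ≤ di z y → z ≤ di x y := fun x y z h =>
    (le_di_di z y).trans (di_anti _ _ y h)
  -- The product is recovered from the derived implication: `x ⊙ ⌐y = ⌐(x ⇒ y)`.
  have mul_neg_eq : ∀ x y : A, mul x (neg y) = neg (di x y) := fun x y => by
    apply le_antisymm
    · exact (le_di_iff _ _ _).mp (le_di_comm _ _ _ le_rfl)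
    · rw [← neg_neg' (mul x (neg y)), neg_le_neg_iff']
      apply le_di_comm
      rw [le_di_iff, neg_neg']
  have plus_eq : ∀ x y : A, plus x y = di (neg x) y := fun x y => by
    rw [hplus, mul_neg_eq, neg_neg']
  refine ⟨fun x => ?_, neg_neg', fun x y => ?_, fun x y z => ?_⟩
  · rw [hplus, neg_bot, hint, neg_neg']
  · simp only [plus_eq, neg_neg']
    exact hLuk x y
  · simp only [plus_eq, neg_neg', neg_bot]
    exact di_eq_top _ _ (di_anti _ _ z (le_di_di _ _))
end

section
/- Let (A, ⇒, 1) be an algebra of type (2,0) satisfying, for all x, y, z ∈ A: (i) x ⇒ x = 1, x ⇒ 1 = 1, 1 ⇒ x = x; (ii) y ⇒ (x ⇒ y) = 1; (iii) (x ⇒ y) ⇒ y = (y ⇒ x) ⇒ x; (iv) (((x ⇒ y) ⇒ y) ⇒ z) ⇒ (x ⇒ z) = 1. Define x ≤ y if and only if x ⇒ y = 1. Then ≤ is a partial order on A, (A, ≤) is a join-semilattice with greatest element 1 in which x ∨ y = (x ⇒ y) ⇒ y; moreover x ≤ y implies y ⇒ z ≤ x ⇒ z, and ((x ⇒ y) ⇒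 y) ⇒ y = x ⇒ y for all x, y ∈ A. -/
/-- Proposition 5: let `(A, ⇒, 1)` (written `imp`, `one`) satisfy
(i) `x ⇒ x = 1`, `x ⇒ 1 = 1`, `1 ⇒ x = x`; (ii) `y ⇒ (x ⇒ y) = 1`;
(iii) `(x ⇒ y) ⇒ y = (y ⇒ x) ⇒ x`;
(iv) `(((x ⇒ y) ⇒ y) ⇒ z) ⇒ (x ⇒ z) = 1`.
Define `x ≤ y` iff `x ⇒ y = 1`.  Then `≤` is a partial order, `(A, ≤)` is a
join-semilattice with greatest element `1` in which
`x ∨ y = (x ⇒ y) ⇒ y`; moreover `x ≤ y` implies `y ⇒ z ≤ x ⇒ z`, and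
`((x ⇒ y) ⇒ y) ⇒ y = x ⇒ y`. -/
theorem stmt_17 {A : Type*} (imp : A → A → A) (one : A)
    (h1 : ∀ x : A, imp x x = one)
    (h1' : ∀ x : A, imp x one = one)
    (h1'' : ∀ x : A, imp one x = x)
    (h2 : ∀ x y : A, imp y (imp x y) = one)
    (h3 : ∀ x y : A, imp (imp x y) y = imp (imp y x) x)
    (h4 : ∀ x y z : A, imp (imp (imp (imp x y) y) z) (imp x z) = one)
    (le : A → A → Prop) (hle : ∀ x y : A, le x y ↔ imp x y = one) :
    -- partial order
    (∀ x : A, le x x) ∧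
    (∀ x y : A, le x y → le y x → x = y) ∧
    (∀ x y z : A, le x y → le y z → le x z) ∧
    -- greatest element
    (∀ x : A, le x one) ∧
    -- `(x ⇒ y) ⇒ y` is the join of `x` and `y`
    (∀ x y : A, le x (imp (imp x y) y) ∧ le y (imp (imp x y) y) ∧
      ∀ z : A, le x z → le y z → le (imp (imp x y) y) z) ∧
    -- antitone in the first argument
    (∀ x y z : A, le x y → le (imp y z) (imp x z)) ∧
    (∀ x y : A, imp (imp (imp x y) y) y = imp x y) := by
  have anti : ∀ x y z, imp x y = one → imp (imp y z) (imp x z) = one := by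
    intro x y z h
    have := h4 x y z
    rwa [h, h1''] at this
  have antisymm : ∀ x y, imp x y = one → imp y x = one → x = y := by
    intro x y hxy hyx
    have := h3 x y
    rw [hxy, hyx, h1'', h1''] at this
    exact this.symm
  have left : ∀ x y, imp x (imp (imp x y) y) = one := by
    intro x y
    have := h4 x y (imp (imp x y) y)
    rwa [h1, h1''] at this
  simp only [hle]
  refine ⟨h1, antisymm, ?_, h1', ?_, anti, ?_⟩
  · intro x y z hxy hyz
    have := anti x y z hxy
    rwa [hyz, h1''] at this
  · refine fun x y => ⟨left x y, h2 _ _, fun z hx hy => ?_⟩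
    have := anti _ _ y (anti x z y hx)
    rwa [h3 z y, hy, h1''] at this
  · exact fun x y => antisymm _ _ (anti _ _ y (left x y)) (left _ _)
end

section
/- Let (A, ⇒, 0) be an algebra of type (2,0), set 1 := 0 ⇒ 0, and suppose ⇒ satisfies, for all x, y, z ∈ A: (i) x ⇒ x = 1, x ⇒ 1 = 1, 1 ⇒ x = x; (ii) y ⇒ (x ⇒ y) = 1; (iii) (x ⇒ y) ⇒ y = (y ⇒ x) ⇒ x; (iv) (((x ⇒ y) ⇒ y) ⇒ z) ⇒ (x ⇒ z) = 1; and (I5) 0 ⇒ x = 1. Define ⌐x := x ⇒ 0 and x ⊕ y := ⌐x ⇒ y. Then (A, ⊕, ⌐, 0) is a basic algebra, and its implication ⌐x ⊕ y coincides with x ⇒ y for all x, y ∈ A. -/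
/-- Theorem 6: let `(A, ⇒, 0)` (written `imp`, `z`) with `1 := 0 ⇒ 0` satisfy
(i) `x ⇒ x = 1`, `x ⇒ 1 = 1`, `1 ⇒ x = x`; (ii) `y ⇒ (x ⇒ y) = 1`;
(iii) `(x ⇒ y) ⇒ y = (y ⇒ x) ⇒ x`;
(iv) `(((x ⇒ y) ⇒ y) ⇒ z) ⇒ (x ⇒ z) = 1`; and (I5) `0 ⇒ x = 1`.
Defining `⌐x := x ⇒ 0` and `x ⊕ y := ⌐x ⇒ y`, the algebra `(A, ⊕, ⌐, 0)` is
a basic algebra whose implication `⌐x ⊕ y` coincides with `⇒`. -/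
theorem stmt_18 {A : Type*} (imp : A → A → A) (z : A)
    (one : A) (hone : one = imp z z)
    (h1 : ∀ x : A, imp x x = one)
    (h1' : ∀ x : A, imp x one = one)
    (h1'' : ∀ x : A, imp one x = x)
    (h2 : ∀ x y : A, imp y (imp x y) = one)
    (h3 : ∀ x y : A, imp (imp x y) y = imp (imp y x) x)
    (h4 : ∀ x y w : A, imp (imp (imp (imp x y) y) w) (imp x w) = one)
    (hI5 : ∀ x : A, imp z x = one)
    (neg : A → A) (hneg : ∀ x : A, neg x = imp x z)
    (plus : A → A → A) (hplus : ∀ x y : A, plus x y = imp (neg x) y) :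
    -- basic algebra axioms
    (∀ x : A, plus x z = x) ∧
    (∀ x : A, neg (neg x) = x) ∧
    (∀ x y : A, plus (neg (plus (neg x) y)) y = plus (neg (plus (neg y) x)) x) ∧
    (∀ x y w : A,
      plus (neg (plus (neg (plus (neg (plus x y)) y)) w)) (plus x w) = neg z) ∧
    -- the implication of the basic algebra coincides with `⇒`
    (∀ x y : A, plus (neg x) y = imp x y) := by
  have hnn : ∀ x : A, neg (neg x) = x := fun x => by
    rw [hneg, hneg, h3, hI5, h1'']
  have himp : ∀ x y : A, plus (neg x) y = imp x y := fun x y => by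
    rw [hplus, hnn]
  refine ⟨fun x => ?_, hnn, fun x y => ?_, fun x y w => ?_, himp⟩
  · rw [hplus, ← hneg, hnn]
  · simp only [himp]
    exact h3 x y
  · simp only [himp]
    rw [hplus x y, hplus x w, h4, hneg, hone]
end

section
/- Let G = (L, ∨, ∧, ⊙, →, 0, 1) be a right-residuated l-groupoid. Then: (1) the term p(x,y,z) := [((y → z) ∧ (z → y)) ⊙ x] ∨ [((x → y) ∧ (y → x)) ⊙ z] satisfies p(x,y,y) = x and p(x,x,y) = y for all x, y ∈ L (so G is congruence permutable); (2) if G satisfies the double negation law, then ((x → y) ∧ (y → x)) → 0 = 0 if and only if x = y, for all x, y ∈ L; (3) if G satisfies the double negation law and divisibility, then for all x, y ∈ L, ((x → y) → 0 = x and x ∨ y = x) if and only if y = 0. -/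
/-- Proposition 6: let `G` be a right-residuated l-groupoid, `⌐x := x → ⊥`.
(1) The Mal'cev term
`p(x,y,z) = [((y → z) ∧ (z → y)) ⊙ x] ∨ [((x → y) ∧ (y → x)) ⊙ z]`
satisfies `p(x,y,y) = x` and `p(x,x,y) = y` (so `G` is congruence
permutable).
(2) If `G` satisfies the double negation law, then
`((x → y) ∧ (y → x)) → ⊥ = ⊥` iff `x = y`.
(3) If moreover `G` satisfies divisibility, then
`(x → y) → ⊥ = x` and `x ∨ y = x` hold iff `y = ⊥`. -/
theorem stmt_19 {L : Type*} [Lattice L] [BoundedOrder L]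
    (mul imp : L → L → L)
    (hone : ∀ x : L, mul ⊤ x = x)
    (hadj : ∀ x y z : L, mul x y ≤ z ↔ x ≤ imp y z) :
    (∀ x y : L,
      mul (imp y y ⊓ imp y y) x ⊔ mul (imp x y ⊓ imp y x) y = x ∧
      mul (imp x y ⊓ imp y x) x ⊔ mul (imp x x ⊓ imp x x) y = y) ∧
    ((∀ x : L, imp (imp x ⊥) ⊥ = x) →
      ∀ x y : L, imp (imp x y ⊓ imp y x) ⊥ = ⊥ ↔ x = y) ∧
    ((∀ x : L, imp (imp x ⊥) ⊥ = x) →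
      (∀ x y : L, mul (imp x y) x = x ⊓ y) →
      ∀ x y : L, (imp (imp x y) ⊥ = x ∧ x ⊔ y = x) ↔ y = ⊥) := by
  have imp_eq_top : ∀ x y : L, imp x y = ⊤ ↔ x ≤ y := fun x y => by
    rw [← top_le_iff, ← hadj, hone]
  have imp_self : ∀ x : L, imp x x = ⊤ := fun x => (imp_eq_top x x).2 le_rfl
  refine ⟨fun x y => ⟨?_, ?_⟩, fun hdn x y => ⟨fun h => ?_, ?_⟩,
    fun hdn hdiv x y => ⟨?_, ?_⟩⟩
  · rw [imp_self, inf_idem, hone, sup_eq_left]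
    exact (hadj _ _ _).2 inf_le_right
  · rw [imp_self, inf_idem, hone, sup_eq_right]
    exact (hadj _ _ _).2 inf_le_left
  · have h_top : imp x y ⊓ imp y x = ⊤ := by
      rw [← hdn (imp x y ⊓ imp y x), h, imp_self]
    obtain ⟨hxy, hyx⟩ := inf_eq_top_iff.1 h_top
    exact le_antisymm ((imp_eq_top x y).1 hxy) ((imp_eq_top y x).1 hyx)
  · rintro rfl
    rw [imp_self, inf_idem, ← imp_self ⊥, hdn]
  · rintro ⟨hneg, hsup⟩
    have h_imp : imp x y = imp x ⊥ := by rw [← hdn (imp x y), hneg]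
    rw [← inf_eq_right.2 (sup_eq_left.1 hsup), ← hdiv, h_imp, hdiv, inf_bot_eq]
  · rintro rfl
    exact ⟨hdn x, sup_bot_eq x⟩
end
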